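/- Contraction (c) is hp-admissible in S(O): if the sequent Γ ⊢ Δ, x : C, x : C has a proof of height h in S(O), then Γ ⊢ Δ, x : C has a proof of height at most h in S(O). -/

import Mathlib

set_option maxHeartbeats 1000000

namespace RIQ

/-- Roles: role names and inverse roles. -/
inductive Role : Type
  | name : ℕ → Role
  | inv  : ℕ → Role
deriving DecidableEq

/-- The inverse of a role. -/
def Role.invert : Role → Role
  | .name r => .inv r
  | .inv r  => .name r

/-- RIQ concepts in negation normal form. -/
inductive Concept : Type
  | atom : ℕ → Concept
  | nneg : ℕ → Concept
  | inter : Concept → Concept → Concept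
  | union : Concept → Concept → Concept
  | ex : Role → Concept → Concept
  | all : Role → Concept → Concept
  | atMost : ℕ → Role → Concept → Concept
  | atLeast : ℕ → Role → Concept → Concept
deriving DecidableEq

/-- ⊤ := A₀ ⊔ ¬A₀ for the fixed concept name A₀ = 0. -/
def topC : Concept := .union (.atom 0) (.nneg 0)

/-- ⊥ := A₀ ⊓ ¬A₀ for the fixed concept name A₀ = 0. -/
def botC : Concept := .inter (.atom 0) (.nneg 0)

/-- NNF-negation. -/
def nnfNeg : Concept → Concept
  | .atom A => .nneg A
  | .nneg A => .atom A
  | .inter C D => .union (nnfNeg C) (nnfNeg D)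
  | .union C D => .inter (nnfNeg C) (nnfNeg D)
  | .ex r C => .all r (nnfNeg C)
  | .all r C => .ex r (nnfNeg C)
  | .atMost n r C => .atLeast (n+1) r C
  | .atLeast 0 _ _ => botC
  | .atLeast (n+1) r C => .atMost n r C

/-- Literals: concept names and their negations. -/
def IsLiteral : Concept → Prop
  | .atom _ => True
  | .nneg _ => True
  | _ => False

/-- A complex role inclusion axiom r₁ ∘ ⋯ ∘ rₙ ⊑ s. -/
structure RIA where
  lhs : List Role
  rhs : Role
deriving DecidableEq

/-- An ontology: a finite set of RIAs (RBox) together with a finite set of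
GCIs (TBox), each GCI ⊤ ⊑ C being recorded by its right-hand concept C. -/
structure Ontology where
  rias : Finset RIA
  gcis : Finset Concept

/-- Union of two ontologies. -/
def Ontology.union (O₁ O₂ : Ontology) : Ontology := ⟨O₁.rias ∪ O₂.rias, O₁.gcis ∪ O₂.gcis⟩

/-- Concept names occurring in a concept. -/
def cnames : Concept → Finset ℕ
  | .atom A => {A}
  | .nneg A => {A}
  | .inter C D => cnames C ∪ cnames D
  | .union C D => cnames C ∪ cnames D
  | .ex _ C => cnames C
  | .all _ C => cnames C
  | .atMost _ _ C => cnames C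
  | .atLeast _ _ C => cnames C

/-- Concept names occurring in an ontology. -/
def Ontology.cnames (O : Ontology) : Finset ℕ := O.gcis.sup RIQ.cnames

/-- An interpretation over the domain δ. -/
structure Interp (δ : Type) where
  cI : ℕ → Set δ
  rI : ℕ → Set (δ × δ)

/-- Interpretation of roles. -/
def Interp.roleI {δ : Type} (I : Interp δ) : Role → Set (δ × δ)
  | .name r => I.rI r
  | .inv r  => {p | (p.2, p.1) ∈ I.rI r}

/-- Relational composition of a list of roles (empty composition is the identity). -/
def Interp.listComp {δ : Type} (I : Interp δ) : List Role → Set (δ × δ)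
  | [] => {p | p.1 = p.2}
  | r :: rs => {p | ∃ b, (p.1, b) ∈ I.roleI r ∧ (b, p.2) ∈ I.listComp rs}

/-- Interpretation of concepts. -/
def Interp.cInterp {δ : Type} (I : Interp δ) : Concept → Set δ
  | .atom A => I.cI A
  | .nneg A => (I.cI A)ᶜ
  | .inter C D => I.cInterp C ∩ I.cInterp D
  | .union C D => I.cInterp C ∪ I.cInterp D
  | .ex r C => {a | ∃ b, (a, b) ∈ I.roleI r ∧ b ∈ I.cInterp C}
  | .all r C => {a | ∀ b, (a, b) ∈ I.roleI r → b ∈ I.cInterp C}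
  | .atMost n r C => {a | {b | (a, b) ∈ I.roleI r ∧ b ∈ I.cInterp C}.encard ≤ (n : ℕ∞)}
  | .atLeast n r C => {a | (n : ℕ∞) ≤ {b | (a, b) ∈ I.roleI r ∧ b ∈ I.cInterp C}.encard}

/-- I ⊨ O. -/
def Interp.models {δ : Type} (I : Interp δ) (O : Ontology) : Prop :=
  (∀ C ∈ O.gcis, I.cInterp topC ⊆ I.cInterp C) ∧
  (∀ ria ∈ O.rias, I.listComp ria.lhs ⊆ I.roleI ria.rhs)

/-- O ⊨ C ⊑ D. -/
def entails (O : Ontology) (C D : Concept) : Prop :=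
  ∀ (δ : Type) [Nonempty δ] (I : Interp δ), I.models O → I.cInterp C ⊆ I.cInterp D

/-- Production rules of the R-system G(O). -/
def ProdRule (O : Ontology) (s : Role) (T : List Role) : Prop :=
  ∃ ria ∈ O.rias, (s = ria.rhs ∧ T = ria.lhs) ∨
    (s = ria.rhs.invert ∧ T = (ria.lhs.map Role.invert).reverse)

/-- One-step derivation in the R-system G(O). -/
def OneStep (O : Ontology) (S R : List Role) : Prop :=
  ∃ S' s T R', ProdRule O s T ∧ S = S' ++ s :: R' ∧ R = S' ++ T ++ R'

/-- The language L_{G(O)}(r). -/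
def lang (O : Ontology) (r : Role) : Set (List Role) :=
  {S | Relation.ReflTransGen (OneStep O) [r] S}

/-- Structural atoms: role atoms, equality atoms and inequality atoms
(labels are natural numbers). -/
inductive SAtom : Type
  | rel : Role → ℕ → ℕ → SAtom
  | eq : ℕ → ℕ → SAtom
  | neq : ℕ → ℕ → SAtom
deriving DecidableEq

/-- Labels occurring in a structural atom. -/
def SAtom.labels : SAtom → Finset ℕ
  | .rel _ x y => {x, y}
  | .eq x y => {x, y}
  | .neq x y => {x, y}

/-- Labeled concepts. -/
abbrev LC := ℕ × Concept

/-- Labels occurring in a finite set of structural atoms. -/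
def labSetF (Γ : Finset SAtom) : Finset ℕ := Γ.biUnion SAtom.labels

/-- Labels occurring in a multiset of labeled concepts. -/
def Δlabels (Δ : Multiset LC) : Finset ℕ := (Δ.map Prod.fst).toFinset

/-- One step of the equality chain x ≈ y (an equality atom in either orientation). -/
def eqStep (Γ : Set SAtom) (x y : ℕ) : Prop := SAtom.eq x y ∈ Γ ∨ SAtom.eq y x ∈ Γ

/-- x ∼_Γ y : x and y are linked by a finite chain of equality atoms of Γ. -/
def eqRel (Γ : Set SAtom) : ℕ → ℕ → Prop := Relation.ReflTransGen (eqStep Γ)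

/-- Edge of the propagation graph PG(Γ) between the classes of x and y, labeled r. -/
def pgEdge (Γ : Set SAtom) (x : ℕ) (r : Role) (y : ℕ) : Prop :=
  (∃ z w, eqRel Γ x z ∧ eqRel Γ y w ∧ SAtom.rel r z w ∈ Γ) ∨
  (∃ z w, eqRel Γ y z ∧ eqRel Γ x w ∧ SAtom.rel r.invert z w ∈ Γ)

/-- Propagation paths: PG(Γ) ⊨ [x]_Γ ⟶^S [y]_Γ for a string S of roles. -/
def pgPath (Γ : Set SAtom) : List Role → ℕ → ℕ → Prop
  | [], x, y => eqRel Γ x y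
  | r :: S, x, y => ∃ z, pgEdge Γ x r z ∧ pgPath Γ S z y

/-- PG(Γ) ⊨ [x]_Γ ⟶^L [y]_Γ with L = L_{G(O)}(r). -/
def pgLang (Γ : Set SAtom) (O : Ontology) (r : Role) (x y : ℕ) : Prop :=
  ∃ S ∈ lang O r, pgPath Γ S x y

/-- The edge relation of the directed graph determined by the role atoms of Γ. -/
def edgeRel (Γ : Set SAtom) (x y : ℕ) : Prop := ∃ r, SAtom.rel r x y ∈ Γ

/-- Γ forms a (directed) tree. -/
def FormsTree (Γ : Finset SAtom) : Prop :=
  Γ = ∅ ∨ ∃ root ∈ labSetF Γ,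
    (∀ x ∈ labSetF Γ, Relation.ReflTransGen (edgeRel ↑Γ) root x) ∧
    (∀ y, ¬ edgeRel ↑Γ y root) ∧
    (∀ x y y', edgeRel ↑Γ y x → edgeRel ↑Γ y' x → y = y')

/-- Γ ⊢ Δ is a sequent. -/
def IsSequent (Γ : Finset SAtom) (Δ : Multiset LC) : Prop :=
  FormsTree Γ ∧
  (Γ ≠ ∅ → ∀ p ∈ Δ, p.1 ∈ labSetF Γ) ∧
  (Γ = ∅ → ∃ x, Δlabels Δ = {x})

/-- y : O̅, the multiset of labeled concepts y : ¬̇C for the GCIs ⊤ ⊑ C of O. -/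
def obar (O : Ontology) (y : ℕ) : Multiset LC := O.gcis.val.map (fun C => (y, nnfNeg C))

/-- x : O̅ for every label x in a given finite set of labels. -/
def obarFor (O : Ontology) (ls : Finset ℕ) : Multiset LC := ls.val.bind (obar O)

/-- y is fresh, i.e. does not occur in the sequent Γ ⊢ Δ. -/
def FreshLabel (y : ℕ) (Γ : Finset SAtom) (Δ : Multiset LC) : Prop :=
  y ∉ labSetF Γ ∧ ∀ p ∈ Δ, p.1 ≠ y

/-- The set {yᵢ ≠̇ yⱼ | i < j}. -/
def neqSet {n : ℕ} (ys : Fin n → ℕ) : Finset SAtom :=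
  ((Finset.univ : Finset (Fin n × Fin n)).filter (fun p => p.1 < p.2)).image
    (fun p => SAtom.neq (ys p.1) (ys p.2))

/-- The set {r(x, yᵢ) | i}. -/
def relSet {n : ℕ} (r : Role) (x : ℕ) (ys : Fin n → ℕ) : Finset SAtom :=
  (Finset.univ : Finset (Fin n)).image (fun i => SAtom.rel r x (ys i))

/-- The multiset y₀ : ¬̇C, y₀ : O̅, …, yₙ : ¬̇C, yₙ : O̅. -/
def leΔ (O : Ontology) (C : Concept) {n : ℕ} (ys : Fin n → ℕ) : Multiset LC :=
  ∑ i : Fin n, ((ys i, nnfNeg C) ::ₘ obar O (ys i))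

/-- The sequent calculus S(O): `Deriv O Γ Δ n` states that the sequent Γ ⊢ Δ has
a proof in S(O) of height at most n. -/
inductive Deriv (O : Ontology) : Finset SAtom → Multiset LC → ℕ → Prop
  | id (Γ : Finset SAtom) (Δ : Multiset LC) (x A : ℕ) (n : ℕ) :
      Deriv O Γ ((x, Concept.atom A) ::ₘ (x, Concept.nneg A) ::ₘ Δ) n
  | idEq (Γ : Finset SAtom) (Δ : Multiset LC) (x y : ℕ) (n : ℕ)
      (hmem : SAtom.neq x y ∈ Γ) (h : eqRel ↑Γ x y) :
      Deriv O Γ Δ n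
  | subst (Γ : Finset SAtom) (Δ : Multiset LC) (x y : ℕ) (L : Concept) (n : ℕ)
      (hL : IsLiteral L) (h : eqRel ↑Γ x y)
      (p : Deriv O Γ ((x, L) ::ₘ (y, L) ::ₘ Δ) n) :
      Deriv O Γ ((x, L) ::ₘ Δ) (n + 1)
  | orR (Γ : Finset SAtom) (Δ : Multiset LC) (x : ℕ) (C D : Concept) (n : ℕ)
      (p : Deriv O Γ ((x, C) ::ₘ (x, D) ::ₘ Δ) n) :
      Deriv O Γ ((x, Concept.union C D) ::ₘ Δ) (n + 1)
  | andR (Γ : Finset SAtom) (Δ : Multiset LC) (x : ℕ) (C D : Concept) (n : ℕ)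
      (p : Deriv O Γ ((x, C) ::ₘ Δ) n) (q : Deriv O Γ ((x, D) ::ₘ Δ) n) :
      Deriv O Γ ((x, Concept.inter C D) ::ₘ Δ) (n + 1)
  | exR (Γ : Finset SAtom) (Δ : Multiset LC) (x y : ℕ) (r : Role) (C : Concept) (n : ℕ)
      (h : pgLang ↑Γ O r x y)
      (p : Deriv O Γ ((x, Concept.ex r C) ::ₘ (y, C) ::ₘ Δ) n) :
      Deriv O Γ ((x, Concept.ex r C) ::ₘ Δ) (n + 1)
  | allR (Γ : Finset SAtom) (Δ : Multiset LC) (x y : ℕ) (r : Role) (C : Concept) (n : ℕ)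
      (hy : FreshLabel y Γ ((x, Concept.all r C) ::ₘ Δ))
      (p : Deriv O (insert (SAtom.rel r x y) Γ) ((y, C) ::ₘ (obar O y + Δ)) n) :
      Deriv O Γ ((x, Concept.all r C) ::ₘ Δ) (n + 1)
  | leR (Γ : Finset SAtom) (Δ : Multiset LC) (x : ℕ) (r : Role) (C : Concept)
      (k : ℕ) (n : ℕ) (ys : Fin (k + 1) → ℕ)
      (hinj : Function.Injective ys)
      (hfresh : ∀ i, FreshLabel (ys i) Γ ((x, Concept.atMost k r C) ::ₘ Δ))
      (p : Deriv O (Γ ∪ neqSet ys ∪ relSet r x ys) (leΔ O C ys + Δ) n) :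
      Deriv O Γ ((x, Concept.atMost k r C) ::ₘ Δ) (n + 1)
  | geR (Γ : Finset SAtom) (Δ : Multiset LC) (x : ℕ) (r : Role) (C : Concept)
      (k : ℕ) (n : ℕ) (ys : Fin k → ℕ)
      (hpath : ∀ i, pgLang ↑Γ O r x (ys i))
      (p : ∀ i, Deriv O Γ ((ys i, C) ::ₘ (x, Concept.atLeast k r C) ::ₘ Δ) n)
      (q : ∀ i j : Fin k, i < j →
        Deriv O (insert (SAtom.eq (ys i) (ys j)) Γ) ((x, Concept.atLeast k r C) ::ₘ Δ) n) :
      Deriv O Γ ((x, Concept.atLeast k r C) ::ₘ Δ) (n + 1)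

/-- S(O) ⊩ Γ ⊢ Δ. -/
def SProvable (O : Ontology) (Γ : Finset SAtom) (Δ : Multiset LC) : Prop := ∃ n, Deriv O Γ Δ n

/-- Satisfaction of a structural atom under a label assignment. -/
def satAtom {δ : Type} (I : Interp δ) (lam : ℕ → δ) : SAtom → Prop
  | .rel r x y => (lam x, lam y) ∈ I.roleI r
  | .eq x y => lam x = lam y
  | .neq x y => lam x ≠ lam y

/-- I, λ ⊨^∀ Γ. -/
def satAll {δ : Type} (I : Interp δ) (lam : ℕ → δ) (Γ : Set SAtom) : Prop :=
  ∀ a ∈ Γ, satAtom I lam a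

/-- I, λ ⊨^∃ Δ. -/
def satEx {δ : Type} (I : Interp δ) (lam : ℕ → δ) (Δ : Multiset LC) : Prop :=
  ∃ p ∈ Δ, lam p.1 ∈ I.cInterp p.2

/-- ⊨_O Γ ⊢ Δ : validity of a sequent relative to O. -/
def ValidSeq (O : Ontology) (Γ : Finset SAtom) (Δ : Multiset LC) : Prop :=
  ∀ (δ : Type) [Nonempty δ] (I : Interp δ) (lam : ℕ → δ),
    I.models O → satAll I lam ↑Γ → satEx I lam Δ

/-- Label substitution (x/y) on labels: replace y by x. -/
def substLab (x y z : ℕ) : ℕ := if z = y then x else z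

/-- Label substitution (x/y) on structural atoms. -/
def SAtom.substL (x y : ℕ) : SAtom → SAtom
  | .rel r a b => .rel r (substLab x y a) (substLab x y b)
  | .eq a b => .eq (substLab x y a) (substLab x y b)
  | .neq a b => .neq (substLab x y a) (substLab x y b)

/-- Label substitution (x/y) on the antecedent. -/
def substΓ (x y : ℕ) (Γ : Finset SAtom) : Finset SAtom := Γ.image (SAtom.substL x y)

/-- Label substitution (x/y) on the consequent. -/
def substΔ (x y : ℕ) (Δ : Multiset LC) : Multiset LC := Δ.map (fun p => (substLab x y p.1, p.2))

/-- Exactly one of three propositions holds. -/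
def XOr3 (a b c : Prop) : Prop := (a ∧ ¬b ∧ ¬c) ∨ (¬a ∧ b ∧ ¬c) ∨ (¬a ∧ ¬b ∧ c)

/-- A member Γᵢ ⊢ Δᵢ of an interpolant. -/
abbrev ISeq := (Finset SAtom) × (Finset LC)

/-- 𝒢 is an interpolant: every member's antecedent consists of equality and
inequality atoms between distinct labels. -/
def IsInterpolant (G : Finset ISeq) : Prop :=
  ∀ p ∈ G, ∀ a ∈ p.1, ∃ x y : ℕ, x ≠ y ∧ (a = SAtom.eq x y ∨ a = SAtom.neq x y)

/-- The orthogonality condition between a member p of 𝒢 and a candidate q. -/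
def orthCond (p q : ISeq) : Prop :=
  XOr3 (∃ x y, SAtom.eq x y ∈ q.1 ∧ SAtom.neq x y ∈ p.1)
       (∃ x y, SAtom.neq x y ∈ q.1 ∧ SAtom.eq x y ∈ p.1)
       (∃ x C, (x, nnfNeg C) ∈ q.2 ∧ (x, C) ∈ p.2)

/-- The orthogonal 𝒢^⊥. -/
def OrthP (G : Set ISeq) : Set ISeq := {q | ∀ p ∈ G, orthCond p q}

/-- Labels occurring in a member of an interpolant. -/
def iseqLabels (p : ISeq) : Finset ℕ := labSetF p.1 ∪ p.2.image Prod.fst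

/-- Concept names occurring in a multiset of labeled concepts. -/
def ΔcnamesS (Δ : Multiset LC) : Set ℕ := {A | ∃ p ∈ Δ, A ∈ cnames p.2}

/-- Disjunction of a list of concepts. -/
def bigUnionL : List Concept → Concept
  | [] => botC
  | [C] => C
  | C :: D :: L => .union C (bigUnionL (D :: L))

/-- Conjunction of a list of concepts. -/
def bigInterL : List Concept → Concept
  | [] => topC
  | [C] => C
  | C :: D :: L => .inter C (bigInterL (D :: L))

/-- ⊓⊔𝒢 : the conjunction of the disjunctions of the members of 𝒢. -/
def interUnion (G : List (List Concept)) : Concept := bigInterL (G.map bigUnionL)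

/-- The interpolant {(⊢ x : C_{i,1}, …, x : C_{i,k_i}) | 1 ≤ i ≤ n}, as a set of ISeqs. -/
def simpleG (x : ℕ) (G : List (List Concept)) : Set ISeq :=
  {p | ∃ S ∈ G, p = (∅, (S.map (fun C => (x, C))).toFinset)}

/-- Renaming of concept names in a concept. -/
def renameC (ρ : ℕ → ℕ) : Concept → Concept
  | .atom A => .atom (ρ A)
  | .nneg A => .nneg (ρ A)
  | .inter C D => .inter (renameC ρ C) (renameC ρ D)
  | .union C D => .union (renameC ρ C) (renameC ρ D)
  | .ex r C => .ex r (renameC ρ C)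
  | .all r C => .all r (renameC ρ C)
  | .atMost n r C => .atMost n r (renameC ρ C)
  | .atLeast n r C => .atLeast n r (renameC ρ C)

/-- Renaming of concept names in an ontology. -/
def renameO (ρ : ℕ → ℕ) (O : Ontology) : Ontology := ⟨O.rias, O.gcis.image (renameC ρ)⟩

/-- C is implicitly concept-definable from Θ under O. -/
def ImplicitlyDefinable (C : Concept) (O : Ontology) (Θ : Finset ℕ) : Prop :=
  ∀ (δ : Type) [Nonempty δ] (I J : Interp δ), I.models O → J.models O →
    (∀ r, I.rI r = J.rI r) → (∀ A ∈ Θ, I.cI A = J.cI A) →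
    I.cInterp C = J.cInterp C

/-- C is explicitly concept-definable from Θ under O. -/
def ExplicitlyDefinable (C : Concept) (O : Ontology) (Θ : Finset ℕ) : Prop :=
  ∃ D : Concept, cnames D ⊆ Θ ∧ entails O C D ∧ entails O D C

/-- RIQ has the concept interpolation property. -/
def ConceptInterpolationProperty : Prop :=
  ∀ (O₁ O₂ : Ontology) (C D : Concept), entails (O₁.union O₂) C D →
    ∃ I : Concept, cnames I ⊆ (cnames C ∪ O₁.cnames) ∩ (cnames D ∪ O₂.cnames) ∧
      entails (O₁.union O₂) C I ∧ entails (O₁.union O₂) I D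

/-- RIQ has the concept-based Beth definability property. -/
def CBP : Prop :=
  ∀ (C : Concept) (O : Ontology) (Θ : Finset ℕ), Θ ⊆ cnames C ∪ O.cnames →
    ImplicitlyDefinable C O Θ → ExplicitlyDefinable C O Θ

/-- Label renaming on structural atoms. -/
def SAtom.rename (f : ℕ → ℕ) : SAtom → SAtom
  | .rel r a b => .rel r (f a) (f b)
  | .eq a b => .eq (f a) (f b)
  | .neq a b => .neq (f a) (f b)

/-- A labeled concept is covered by the sequent `Γ ⊢ Δ` if it occurs in `Δ`, or if the result of
decomposing it by one of the invertible rules (⊔), (⊓), (∀r), (≤n r) is covered. -/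
inductive Covered (O : Ontology) (Γ : Finset SAtom) (Δ : Multiset LC) : LC → Prop
  | mem {p : LC} (h : p ∈ Δ) : Covered O Γ Δ p
  | union {x : ℕ} {C D : Concept} (hC : Covered O Γ Δ (x, C)) (hD : Covered O Γ Δ (x, D)) :
      Covered O Γ Δ (x, .union C D)
  | interLeft {x : ℕ} {C D : Concept} (hC : Covered O Γ Δ (x, C)) :
      Covered O Γ Δ (x, .inter C D)
  | interRight {x : ℕ} {C D : Concept} (hD : Covered O Γ Δ (x, D)) :
      Covered O Γ Δ (x, .inter C D)
  | all {x : ℕ} (y : ℕ) {r : Role} {C : Concept} (hr : SAtom.rel r x y ∈ Γ)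
      (hC : Covered O Γ Δ (y, C)) (hO : ∀ p ∈ obar O y, Covered O Γ Δ p) :
      Covered O Γ Δ (x, .all r C)
  | atMost {x k : ℕ} (ys : Fin (k + 1) → ℕ) {r : Role} {C : Concept}
      (hn : neqSet ys ⊆ Γ) (hr : relSet r x ys ⊆ Γ)
      (hΔ : ∀ p ∈ leΔ O C ys, Covered O Γ Δ p) :
      Covered O Γ Δ (x, .atMost k r C)

theorem Covered.trans {O : Ontology} {Γ Γ' : Finset SAtom} {Δ Δ' : Multiset LC} {p : LC}
    (hp : Covered O Γ Δ p) (hΓ : Γ ⊆ Γ') (hΔ : ∀ q ∈ Δ, Covered O Γ' Δ' q) :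
    Covered O Γ' Δ' p := by
  induction hp with
  | mem h => exact hΔ _ h
  | union _ _ ihC ihD => exact .union ihC ihD
  | interLeft _ ih => exact .interLeft ih
  | interRight _ ih => exact .interRight ih
  | all y hr _ _ ihC ihO => exact .all y (hΓ hr) ihC ihO
  | atMost ys hn hr _ ih => exact .atMost ys (hn.trans hΓ) (hr.trans hΓ) ih

/-- Replacing an element of the succedent that the new sequent still covers. -/
theorem Covered.replace {O : Ontology} {Γ Γ' : Finset SAtom} {Δ E : Multiset LC} {p q : LC}
    (hp : Covered O Γ (q ::ₘ Δ) p) (hΓ : Γ ⊆ Γ') (hE : Δ ⊆ E) (hq : Covered O Γ' E q) :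
    Covered O Γ' E p := by
  refine hp.trans hΓ fun q' hq' => ?_
  rcases Multiset.mem_cons.1 hq' with rfl | h
  · exact hq
  · exact .mem (hE h)

section Rename

variable {Γ Γ' : Finset SAtom} {f : ℕ → ℕ}

theorem eqRel_rename (hΓ : ∀ a ∈ Γ, a.rename f ∈ Γ') {x y : ℕ} (h : eqRel ↑Γ x y) :
    eqRel ↑Γ' (f x) (f y) := by
  refine Relation.ReflTransGen.lift f (fun a b hab => ?_) _ _ h
  exact hab.imp (hΓ (.eq a b)) (hΓ (.eq b a))

theorem pgPath_rename (hΓ : ∀ a ∈ Γ, a.rename f ∈ Γ') :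
    ∀ (S : List Role) {x y : ℕ}, pgPath ↑Γ S x y → pgPath ↑Γ' S (f x) (f y)
  | [], _, _, h => eqRel_rename hΓ h
  | _ :: S, _, _, ⟨z, he, hp⟩ => by
      refine ⟨f z, ?_, pgPath_rename hΓ S hp⟩
      rcases he with ⟨a, b, ha, hb, hr⟩ | ⟨a, b, ha, hb, hr⟩
      · exact .inl ⟨f a, f b, eqRel_rename hΓ ha, eqRel_rename hΓ hb, hΓ _ hr⟩
      · exact .inr ⟨f a, f b, eqRel_rename hΓ ha, eqRel_rename hΓ hb, hΓ _ hr⟩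

theorem pgLang_rename {O : Ontology} {r : Role} (hΓ : ∀ a ∈ Γ, a.rename f ∈ Γ') {x y : ℕ}
    (h : pgLang ↑Γ O r x y) : pgLang ↑Γ' O r (f x) (f y) := by
  obtain ⟨S, hS, hp⟩ := h
  exact ⟨S, hS, pgPath_rename hΓ S hp⟩

end Rename

theorem SAtom.rename_congr {f g : ℕ → ℕ} {a : SAtom} (h : ∀ z ∈ a.labels, f z = g z) :
    a.rename f = a.rename g := by
  cases a <;> simp_all [SAtom.rename, SAtom.labels]

theorem mem_labSetF {Γ : Finset SAtom} {a : SAtom} (ha : a ∈ Γ) {z : ℕ} (hz : z ∈ a.labels) :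
    z ∈ labSetF Γ :=
  Finset.mem_biUnion.2 ⟨a, ha, hz⟩

theorem mem_obar {O : Ontology} {y : ℕ} {p : LC} :
    p ∈ obar O y ↔ ∃ C ∈ O.gcis, (y, nnfNeg C) = p := by
  simp [obar]

theorem mem_leΔ {O : Ontology} {C : Concept} {n : ℕ} {ys : Fin n → ℕ} {p : LC} :
    p ∈ leΔ O C ys ↔ ∃ i, p = (ys i, nnfNeg C) ∨ p ∈ obar O (ys i) := by
  simp [leΔ, Multiset.mem_sum]

theorem mem_neqSet {n : ℕ} {ys : Fin n → ℕ} {a : SAtom} :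
    a ∈ neqSet ys ↔ ∃ i j, i < j ∧ SAtom.neq (ys i) (ys j) = a := by
  simp [neqSet]

theorem mem_relSet {n : ℕ} {r : Role} {x : ℕ} {ys : Fin n → ℕ} {a : SAtom} :
    a ∈ relSet r x ys ↔ ∃ i, SAtom.rel r x (ys i) = a := by
  simp [relSet]

theorem rename_mem_obar {O : Ontology} {f : ℕ → ℕ} {y : ℕ} {p : LC} (hp : p ∈ obar O y) :
    (f p.1, p.2) ∈ obar O (f y) := by
  obtain ⟨C, hC, rfl⟩ := mem_obar.1 hp
  exact mem_obar.2 ⟨C, hC, rfl⟩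

theorem rename_mem_leΔ {O : Ontology} {C : Concept} {f : ℕ → ℕ} {n : ℕ} {ys : Fin n → ℕ} {p : LC}
    (hp : p ∈ leΔ O C ys) : (f p.1, p.2) ∈ leΔ O C (f ∘ ys) := by
  obtain ⟨i, rfl | h⟩ := mem_leΔ.1 hp
  · exact mem_leΔ.2 ⟨i, .inl rfl⟩
  · exact mem_leΔ.2 ⟨i, .inr (rename_mem_obar h)⟩

/-- Every label from some bound on is fresh. -/
theorem exists_forall_freshLabel (Γ : Finset SAtom) (Δ : Multiset LC) :
    ∃ N, ∀ y, N ≤ y → FreshLabel y Γ Δ := by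
  refine ⟨(labSetF Γ ∪ Δlabels Δ).sup id + 1, fun y hy => ?_⟩
  have key : y ∉ labSetF Γ ∪ Δlabels Δ := fun h => by
    have : y ≤ (labSetF Γ ∪ Δlabels Δ).sup id := Finset.le_sup (f := id) h
    omega
  rw [Finset.mem_union, not_or] at key
  refine ⟨key.1, fun p hp h => key.2 ?_⟩
  simp only [Δlabels, Multiset.mem_toFinset, Multiset.mem_map]
  exact ⟨p, hp, h⟩

/-- Height-preserving renaming, weakening, inversion and contraction in one statement: a proof of
`Γ ⊢ Δ` yields a proof, at most as high, of any sequent that contains a renaming of `Γ` and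
covers the corresponding renaming of `Δ`. -/
theorem Deriv.of_covered {O : Ontology} {Γ : Finset SAtom} {Δ : Multiset LC} {n : ℕ}
    (hd : Deriv O Γ Δ n) : ∀ {m : ℕ} {f : ℕ → ℕ} {Γ' : Finset SAtom} {Δ' : Multiset LC}, n ≤ m →
      (∀ a ∈ Γ, a.rename f ∈ Γ') → (∀ p ∈ Δ, Covered O Γ' Δ' (f p.1, p.2)) →
      Deriv O Γ' Δ' m := by
  induction hd with
  | id Γ Δ x A n =>
    intro m f Γ' Δ' _ _ hΔ
    simp only [Multiset.mem_cons, forall_eq_or_imp] at hΔ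
    obtain ⟨⟨h₁⟩, ⟨h₂⟩, -⟩ := hΔ
    obtain ⟨E, rfl⟩ := Multiset.exists_cons_of_mem h₁
    have h₂ : (f x, Concept.nneg A) ∈ E := by simpa using h₂
    obtain ⟨E, rfl⟩ := Multiset.exists_cons_of_mem h₂
    exact .id Γ' E (f x) A m
  | idEq Γ Δ x y n hmem h =>
    intro m f Γ' Δ' _ hΓ _
    exact .idEq Γ' Δ' (f x) (f y) m (hΓ _ hmem) (eqRel_rename hΓ h)
  | subst Γ Δ x y L n hL h p ih =>
    intro m f Γ' Δ' hm hΓ hΔ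
    obtain ⟨m, rfl⟩ := Nat.exists_eq_add_of_le' (Nat.le_of_add_left_le hm)
    simp only [Multiset.mem_cons, forall_eq_or_imp] at hΔ ih
    obtain ⟨hx, hΔ⟩ := hΔ
    have hx : (f x, L) ∈ Δ' := by
      generalize hp : (f x, L) = p at hx
      cases hx <;> cases hp <;> simp_all [IsLiteral]
    obtain ⟨E, rfl⟩ := Multiset.exists_cons_of_mem hx
    refine .subst Γ' E (f x) (f y) L m hL (eqRel_rename hΓ h)
      (ih (by omega) hΓ ⟨.mem (by simp), .mem (by simp), fun p hp => ?_⟩)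
    exact (hΔ p hp).replace subset_rfl (fun _ h => by simp [h]) (.mem (by simp))
  | orR Γ Δ x C D n p ih =>
    intro m f Γ' Δ' hm hΓ hΔ
    obtain ⟨m, rfl⟩ := Nat.exists_eq_add_of_le' (Nat.le_of_add_left_le hm)
    simp only [Multiset.mem_cons, forall_eq_or_imp] at hΔ ih
    obtain ⟨hx | ⟨hC, hD⟩, hΔ⟩ := hΔ
    · rename_i hx
      obtain ⟨E, rfl⟩ := Multiset.exists_cons_of_mem hx
      refine .orR Γ' E (f x) C D m
        (ih (by omega) hΓ ⟨.mem (by simp), .mem (by simp), fun p hp => ?_⟩)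
      exact (hΔ p hp).replace subset_rfl (fun _ h => by simp [h])
        (.union (.mem (by simp)) (.mem (by simp)))
    · exact ih (by omega) hΓ ⟨hC, hD, hΔ⟩
  | andR Γ Δ x C D n p q ihC ihD =>
    intro m f Γ' Δ' hm hΓ hΔ
    obtain ⟨m, rfl⟩ := Nat.exists_eq_add_of_le' (Nat.le_of_add_left_le hm)
    simp only [Multiset.mem_cons, forall_eq_or_imp] at hΔ ihC ihD
    obtain ⟨hx, hΔ⟩ := hΔ
    cases hx with
    | mem hx =>
      obtain ⟨E, rfl⟩ := Multiset.exists_cons_of_mem hx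
      refine .andR Γ' E (f x) C D m
        (ihC (by omega) hΓ ⟨.mem (by simp), fun p hp => ?_⟩)
        (ihD (by omega) hΓ ⟨.mem (by simp), fun p hp => ?_⟩)
      · exact (hΔ p hp).replace subset_rfl (fun _ h => by simp [h]) (.interLeft (.mem (by simp)))
      · exact (hΔ p hp).replace subset_rfl (fun _ h => by simp [h]) (.interRight (.mem (by simp)))
    | interLeft hC => exact ihC (by omega) hΓ ⟨hC, hΔ⟩
    | interRight hD => exact ihD (by omega) hΓ ⟨hD, hΔ⟩
  | exR Γ Δ x y r C n h p ih =>
    intro m f Γ' Δ' hm hΓ hΔ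
    obtain ⟨m, rfl⟩ := Nat.exists_eq_add_of_le' (Nat.le_of_add_left_le hm)
    simp only [Multiset.mem_cons, forall_eq_or_imp] at hΔ ih
    obtain ⟨⟨hx⟩, hΔ⟩ := hΔ
    obtain ⟨E, rfl⟩ := Multiset.exists_cons_of_mem hx
    refine .exR Γ' E (f x) (f y) r C m (pgLang_rename hΓ h)
      (ih (by omega) hΓ ⟨.mem (by simp), .mem (by simp), fun p hp => ?_⟩)
    exact (hΔ p hp).replace subset_rfl (fun _ h => by simp [h]) (.mem (by simp))
  | allR Γ Δ x y r C n hy p ih =>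
    intro m f Γ' Δ' hm hΓ hΔ
    obtain ⟨m, rfl⟩ := Nat.exists_eq_add_of_le' (Nat.le_of_add_left_le hm)
    simp only [Multiset.mem_cons, forall_eq_or_imp] at hΔ
    obtain ⟨hx, hΔ⟩ := hΔ
    have hxy : x ≠ y := hy.2 (x, _) (Multiset.mem_cons_self _ _)
    have premise : ∀ {k : ℕ} (z : ℕ) {Γ₂ : Finset SAtom} {Δ₂ : Multiset LC}, n ≤ k → Γ' ⊆ Γ₂ →
        SAtom.rel r (f x) z ∈ Γ₂ → Covered O Γ₂ Δ₂ (z, C) →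
        (∀ p ∈ obar O z, Covered O Γ₂ Δ₂ p) →
        (∀ p ∈ Δ, Covered O Γ₂ Δ₂ (f p.1, p.2)) → Deriv O Γ₂ Δ₂ k := by
      intro k z Γ₂ Δ₂ hk hsub hr hC hO hΔ
      refine ih (f := Function.update f y z) hk (fun a ha => ?_) (fun p hp => ?_)
      · rcases Finset.mem_insert.1 ha with rfl | haΓ
        · simpa [SAtom.rename, hxy] using hr
        · rw [SAtom.rename_congr (g := f)]
          · exact hsub (hΓ a haΓ)
          · intro w hw
            refine Function.update_of_ne ?_ _ _
            rintro rfl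
            exact hy.1 (mem_labSetF haΓ hw)
      · rcases Multiset.mem_cons.1 hp with rfl | hp
        · simpa using hC
        rcases Multiset.mem_add.1 hp with hp | hp
        · simpa using hO _ (by simpa using rename_mem_obar (f := Function.update f y z) hp)
        · rw [Function.update_of_ne (hy.2 p (Multiset.mem_cons_of_mem hp))]
          exact hΔ p hp
    cases hx with
    | mem hx =>
      obtain ⟨E, rfl⟩ := Multiset.exists_cons_of_mem hx
      obtain ⟨z, hz⟩ := exists_forall_freshLabel Γ' ((f x, Concept.all r C) ::ₘ E)
      have hC : Covered O (insert (SAtom.rel r (f x) z) Γ') ((z, C) ::ₘ (obar O z + E)) (z, C) :=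
        .mem (by simp)
      have hO : ∀ p ∈ obar O z,
          Covered O (insert (SAtom.rel r (f x) z) Γ') ((z, C) ::ₘ (obar O z + E)) p :=
        fun p hp => .mem (by simp [hp])
      refine .allR Γ' E (f x) z r C m (hz z le_rfl) (premise z (by omega)
        (Finset.subset_insert _ _) (Finset.mem_insert_self _ _) hC hO fun p hp => ?_)
      exact (hΔ p hp).replace (Finset.subset_insert _ _) (fun _ h => by simp [h])
        (.all z (Finset.mem_insert_self _ _) hC hO)
    | all z hr hC hO => exact premise z (by omega) subset_rfl hr hC hO hΔ
  | leR Γ Δ x r C k n ys hinj hfresh p ih =>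
    intro m f Γ' Δ' hm hΓ hΔ
    obtain ⟨m, rfl⟩ := Nat.exists_eq_add_of_le' (Nat.le_of_add_left_le hm)
    simp only [Multiset.mem_cons, forall_eq_or_imp] at hΔ
    obtain ⟨hx, hΔ⟩ := hΔ
    have premise : ∀ {l : ℕ} (zs : Fin (k + 1) → ℕ) {Γ₂ : Finset SAtom} {Δ₂ : Multiset LC},
        n ≤ l → Γ' ⊆ Γ₂ → neqSet zs ⊆ Γ₂ → relSet r (f x) zs ⊆ Γ₂ →
        (∀ p ∈ leΔ O C zs, Covered O Γ₂ Δ₂ p) →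
        (∀ p ∈ Δ, Covered O Γ₂ Δ₂ (f p.1, p.2)) → Deriv O Γ₂ Δ₂ l := by
      intro l zs Γ₂ Δ₂ hl hsub hn hr hle hΔ
      have hext : ∀ i, Function.extend ys zs f (ys i) = zs i := hinj.extend_apply zs f
      have hne : ∀ w, (∀ i, w ≠ ys i) → Function.extend ys zs f w = f w := fun w hw =>
        Function.extend_apply' zs f w fun ⟨i, hi⟩ => hw i hi.symm
      refine ih (f := Function.extend ys zs f) hl (fun a ha => ?_) (fun p hp => ?_)
      · rcases Finset.mem_union.1 ha with ha | ha
        · rcases Finset.mem_union.1 ha with ha | ha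
          · rw [SAtom.rename_congr (g := f)]
            · exact hsub (hΓ a ha)
            · intro w hw
              refine hne w ?_
              rintro i rfl
              exact (hfresh i).1 (mem_labSetF ha hw)
          · obtain ⟨i, j, hij, rfl⟩ := mem_neqSet.1 ha
            exact hn (mem_neqSet.2 ⟨i, j, hij, by simp [SAtom.rename, hext]⟩)
        · obtain ⟨i, rfl⟩ := mem_relSet.1 ha
          refine hr (mem_relSet.2 ⟨i, ?_⟩)
          simp [SAtom.rename, hext,
            hne x fun i => (hfresh i).2 (x, _) (Multiset.mem_cons_self _ _)]
      · rcases Multiset.mem_add.1 hp with hp | hp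
        · have := rename_mem_leΔ (f := Function.extend ys zs f) hp
          rw [show Function.extend ys zs f ∘ ys = zs from funext hext] at this
          exact hle _ this
        · rw [hne p.1 fun i => (hfresh i).2 p (Multiset.mem_cons_of_mem hp)]
          exact hΔ p hp
    cases hx with
    | mem hx =>
      obtain ⟨E, rfl⟩ := Multiset.exists_cons_of_mem hx
      obtain ⟨N, hN⟩ := exists_forall_freshLabel Γ' ((f x, Concept.atMost k r C) ::ₘ E)
      let zs : Fin (k + 1) → ℕ := fun i => N + i
      have hzs : Function.Injective zs := fun i j h => Fin.ext (Nat.add_left_cancel h)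
      have hsub : Γ' ⊆ Γ' ∪ neqSet zs ∪ relSet r (f x) zs := fun a ha => by simp [ha]
      have hn : neqSet zs ⊆ Γ' ∪ neqSet zs ∪ relSet r (f x) zs := fun a ha => by simp [ha]
      have hr : relSet r (f x) zs ⊆ Γ' ∪ neqSet zs ∪ relSet r (f x) zs :=
        Finset.subset_union_right
      have hle : ∀ p ∈ leΔ O C zs,
          Covered O (Γ' ∪ neqSet zs ∪ relSet r (f x) zs) (leΔ O C zs + E) p :=
        fun p hp => .mem (by simp [hp])
      refine .leR Γ' E (f x) r C k m zs hzs (fun i => hN _ (Nat.le_add_right N i))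
        (premise zs (by omega) hsub hn hr hle fun p hp => ?_)
      exact (hΔ p hp).replace hsub (fun _ h => by simp [h]) (.atMost zs hn hr hle)
    | atMost zs hn hr hle => exact premise zs (by omega) subset_rfl hn hr hle hΔ
  | geR Γ Δ x r C k n ys hpath p q ihp ihq =>
    intro m f Γ' Δ' hm hΓ hΔ
    obtain ⟨m, rfl⟩ := Nat.exists_eq_add_of_le' (Nat.le_of_add_left_le hm)
    simp only [Multiset.mem_cons, forall_eq_or_imp] at hΔ ihp ihq
    obtain ⟨⟨hx⟩, hΔ⟩ := hΔ
    obtain ⟨E, rfl⟩ := Multiset.exists_cons_of_mem hx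
    refine .geR Γ' E (f x) r C k m (fun i => f (ys i)) (fun i => pgLang_rename hΓ (hpath i))
      (fun i => ihp i (by omega) hΓ ⟨.mem (by simp), .mem (by simp), fun p hp => ?_⟩)
      (fun i j hij => ihq i j hij (f := f) (by omega) ?_ ⟨.mem (by simp), fun p hp => ?_⟩)
    · exact (hΔ p hp).replace subset_rfl (fun _ h => by simp [h]) (.mem (by simp))
    · intro a ha
      rcases Finset.mem_insert.1 ha with rfl | ha
      · exact Finset.mem_insert_self _ _
      · exact Finset.mem_insert_of_mem (hΓ a ha)
    · exact (hΔ p hp).replace (Finset.subset_insert _ _) (fun _ h => by simp [h])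
        (.mem (by simp))

/-- Contraction (c) is hp-admissible in S(O). -/
theorem contraction_hp_admissible (O : Ontology) (Γ : Finset SAtom) (Δ : Multiset LC)
    (x : ℕ) (C : Concept) (h : ℕ)
    (hd : Deriv O Γ ((x, C) ::ₘ (x, C) ::ₘ Δ) h) :
    Deriv O Γ ((x, C) ::ₘ Δ) h := by
  refine hd.of_covered (f := id) le_rfl (fun a ha => ?_) (fun p hp => .mem ?_)
  · cases a <;> exact ha
  · simpa using hp

end RIQ
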